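/- Let Ω ⊆ ℝ² be open and connected, let f : Ω × ℝ → ℝ be smooth, let C ∈ ℝ, and let η : Ω → ℝ be smooth with ∂η/∂y ≠ 0 everywhere. Suppose that for all (x, y) ∈ Ω and all p ∈ ℝ, η_{xx}(x,y) + 2p·η_{xy}(x,y) + p²·η_{yy}(x,y) + η_y(x,y)·f(x,y,p) = 6·η(x,y)² + x + C. Then f satisfies on Ω × ℝ the identities f_{ppp} = 0 and f_{xpp} = f_{yp} − p·f_{ypp}. -/

import Mathlib

/-- Partial derivative in the first variable `x` of a function of `(x, y, p)`. -/
noncomputable def pdx (g : ℝ → ℝ → ℝ → ℝ) : ℝ → ℝ → ℝ → ℝ :=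
  fun x y p => deriv (fun t => g t y p) x

/-- Partial derivative in the second variable `y` of a function of `(x, y, p)`. -/
noncomputable def pdy (g : ℝ → ℝ → ℝ → ℝ) : ℝ → ℝ → ℝ → ℝ :=
  fun x y p => deriv (fun t => g x t p) y

/-- Partial derivative in the third variable `p` of a function of `(x, y, p)`. -/
noncomputable def pdp (g : ℝ → ℝ → ℝ → ℝ) : ℝ → ℝ → ℝ → ℝ :=
  fun x y p => deriv (fun t => g x y t) p

/-- Partial derivative in `x` of a function of `(x, y)`. -/
noncomputable def edx (g : ℝ → ℝ → ℝ) : ℝ → ℝ → ℝ :=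
  fun x y => deriv (fun t => g t y) x

/-- Partial derivative in `y` of a function of `(x, y)`. -/
noncomputable def edy (g : ℝ → ℝ → ℝ) : ℝ → ℝ → ℝ :=
  fun x y => deriv (fun t => g x t) y

open Filter Topology in
theorem eventually_mem_slices {Ω : Set (ℝ × ℝ)} (hΩ : IsOpen Ω) {x y : ℝ} (h : (x, y) ∈ Ω) :
    (∀ᶠ t in 𝓝 x, (t, y) ∈ Ω) ∧ ∀ᶠ t in 𝓝 y, (x, t) ∈ Ω :=
  ⟨(hΩ.preimage (by fun_prop : Continuous fun t : ℝ => (t, y))).mem_nhds h,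
    (hΩ.preimage (by fun_prop : Continuous fun t : ℝ => (x, t))).mem_nhds h⟩

/-- Smoothness on `Ω` of a curried function of `(x, y)`. -/
def SmoothOn2 (Ω : Set (ℝ × ℝ)) (g : ℝ → ℝ → ℝ) : Prop :=
  ContDiffOn ℝ (⊤ : ℕ∞) (fun w : ℝ × ℝ => g w.1 w.2) Ω

namespace SmoothOn2

variable {Ω : Set (ℝ × ℝ)} {g : ℝ → ℝ → ℝ} {x y : ℝ}

theorem contDiffAt (hg : SmoothOn2 Ω g) (hΩ : IsOpen Ω) {w : ℝ × ℝ} (h : w ∈ Ω) :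
    ContDiffAt ℝ (⊤ : ℕ∞) (fun w : ℝ × ℝ => g w.1 w.2) w :=
  ContDiffOn.contDiffAt hg (hΩ.mem_nhds h)

theorem hasFDerivAt (hg : SmoothOn2 Ω g) (hΩ : IsOpen Ω) {w : ℝ × ℝ} (h : w ∈ Ω) :
    HasFDerivAt (fun w : ℝ × ℝ => g w.1 w.2) (fderiv ℝ (fun w : ℝ × ℝ => g w.1 w.2) w) w :=
  ((hg.contDiffAt hΩ h).differentiableAt (by simp)).hasFDerivAt

theorem hasDerivAt_fst_fderiv (hg : SmoothOn2 Ω g) (hΩ : IsOpen Ω) (h : (x, y) ∈ Ω) :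
    HasDerivAt (fun t => g t y) (fderiv ℝ (fun w : ℝ × ℝ => g w.1 w.2) (x, y) (1, 0)) x :=
  (hg.hasFDerivAt hΩ h).comp_hasDerivAt (f := fun t : ℝ => (t, y)) x
    ((hasDerivAt_id x).prodMk (hasDerivAt_const x y))

theorem hasDerivAt_snd_fderiv (hg : SmoothOn2 Ω g) (hΩ : IsOpen Ω) (h : (x, y) ∈ Ω) :
    HasDerivAt (fun t => g x t) (fderiv ℝ (fun w : ℝ × ℝ => g w.1 w.2) (x, y) (0, 1)) y :=
  (hg.hasFDerivAt hΩ h).comp_hasDerivAt (f := fun t : ℝ => (x, t)) y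
    ((hasDerivAt_const y x).prodMk (hasDerivAt_id y))

theorem edx_eq (hg : SmoothOn2 Ω g) (hΩ : IsOpen Ω) (h : (x, y) ∈ Ω) :
    edx g x y = fderiv ℝ (fun w : ℝ × ℝ => g w.1 w.2) (x, y) (1, 0) :=
  (hg.hasDerivAt_fst_fderiv hΩ h).deriv

theorem edy_eq (hg : SmoothOn2 Ω g) (hΩ : IsOpen Ω) (h : (x, y) ∈ Ω) :
    edy g x y = fderiv ℝ (fun w : ℝ × ℝ => g w.1 w.2) (x, y) (0, 1) :=
  (hg.hasDerivAt_snd_fderiv hΩ h).deriv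

theorem hasDerivAt_edx (hg : SmoothOn2 Ω g) (hΩ : IsOpen Ω) (h : (x, y) ∈ Ω) :
    HasDerivAt (fun t => g t y) (edx g x y) x :=
  hg.edx_eq hΩ h ▸ hg.hasDerivAt_fst_fderiv hΩ h

theorem hasDerivAt_edy (hg : SmoothOn2 Ω g) (hΩ : IsOpen Ω) (h : (x, y) ∈ Ω) :
    HasDerivAt (fun t => g x t) (edy g x y) y :=
  hg.edy_eq hΩ h ▸ hg.hasDerivAt_snd_fderiv hΩ h

theorem contDiffOn_fderiv (hg : SmoothOn2 Ω g) (hΩ : IsOpen Ω) :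
    ContDiffOn ℝ (⊤ : ℕ∞) (fderiv ℝ (fun w : ℝ × ℝ => g w.1 w.2)) Ω :=
  ContDiffOn.fderiv_of_isOpen hg hΩ (by simp)

theorem partial_fst (hg : SmoothOn2 Ω g) (hΩ : IsOpen Ω) : SmoothOn2 Ω (edx g) :=
  ((hg.contDiffOn_fderiv hΩ).clm_apply contDiffOn_const).congr fun _ hw => hg.edx_eq hΩ hw

theorem partial_snd (hg : SmoothOn2 Ω g) (hΩ : IsOpen Ω) : SmoothOn2 Ω (edy g) :=
  ((hg.contDiffOn_fderiv hΩ).clm_apply contDiffOn_const).congr fun _ hw => hg.edy_eq hΩ hw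

/-- Mixed partial derivatives of a smooth function commute. -/
theorem edx_edy_comm (hg : SmoothOn2 Ω g) (hΩ : IsOpen Ω) (h : (x, y) ∈ Ω) :
    edx (edy g) x y = edy (edx g) x y := by
  have hd := (((hg.contDiffOn_fderiv hΩ).contDiffAt (hΩ.mem_nhds h)).differentiableAt
    (by simp)).hasFDerivAt
  have hx := hd.comp_hasDerivAt (f := fun t : ℝ => (t, y)) x
    ((hasDerivAt_id x).prodMk (hasDerivAt_const x y))
  have hy := hd.comp_hasDerivAt (f := fun t : ℝ => (x, t)) y
    ((hasDerivAt_const y x).prodMk (hasDerivAt_id y))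
  have ex := (hx.clm_apply (hasDerivAt_const x ((0, 1) : ℝ × ℝ))).congr_of_eventuallyEq
    ((eventually_mem_slices hΩ h).1.mono fun _ ht => hg.edy_eq hΩ ht)
  have ey := (hy.clm_apply (hasDerivAt_const y ((1, 0) : ℝ × ℝ))).congr_of_eventuallyEq
    ((eventually_mem_slices hΩ h).2.mono fun _ ht => hg.edx_eq hΩ ht)
  have hs : IsSymmSndFDerivAt ℝ (fun w : ℝ × ℝ => g w.1 w.2) (x, y) :=
    (hg.contDiffAt hΩ h).isSymmSndFDerivAt (by
      simpa using (WithTop.coe_le_coe.mpr (le_top : (2 : ℕ∞) ≤ ⊤)))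
  have hxy := hs (1, 0) (0, 1)
  rw [show edx (edy g) x y = _ from ex.deriv,
    show edy (edx g) x y = _ from ey.deriv]
  simpa using hxy

end SmoothOn2

theorem hasDerivAt_quadratic (a b c p : ℝ) :
    HasDerivAt (fun p : ℝ => a + b * p + c * p ^ 2) (b + 2 * c * p) p := by
  have h := (((hasDerivAt_id p).const_mul b).const_add a).add
    (((hasDerivAt_id p).pow 2).const_mul c)
  refine h.congr_deriv ?_
  simp
  ring

section Quadratic

variable {f : ℝ → ℝ → ℝ → ℝ} {x y a b c : ℝ}

theorem pdp_of_quadratic (h : ∀ p, f x y p = a + b * p + c * p ^ 2) (p : ℝ) :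
    pdp f x y p = b + 2 * c * p := by
  rw [pdp, funext h]
  exact (hasDerivAt_quadratic a b c p).deriv

theorem pdp_pdp_of_quadratic (h : ∀ p, f x y p = a + b * p + c * p ^ 2) (p : ℝ) :
    pdp (pdp f) x y p = 2 * c := by
  rw [pdp_of_quadratic (a := b) (b := 2 * c) (c := 0)
    fun q => by rw [pdp_of_quadratic h]; ring]
  ring

theorem pdp_pdp_pdp_of_quadratic (h : ∀ p, f x y p = a + b * p + c * p ^ 2) (p : ℝ) :
    pdp (pdp (pdp f)) x y p = 0 := by
  rw [pdp_of_quadratic (a := 2 * c) (b := 0) (c := 0)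
    fun q => by rw [pdp_pdp_of_quadratic h]; ring]
  ring

end Quadratic

section QuadraticOn

variable {Ω : Set (ℝ × ℝ)} {f : ℝ → ℝ → ℝ → ℝ} {a b c : ℝ → ℝ → ℝ} {x y : ℝ}

theorem pdx_of_quadraticOn (hΩ : IsOpen Ω) (ha : SmoothOn2 Ω a) (hb : SmoothOn2 Ω b)
    (hc : SmoothOn2 Ω c)
    (hf : ∀ x y, (x, y) ∈ Ω → ∀ p, f x y p = a x y + b x y * p + c x y * p ^ 2)
    (h : (x, y) ∈ Ω) (p : ℝ) :
    pdx f x y p = edx a x y + edx b x y * p + edx c x y * p ^ 2 :=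
  ((((ha.hasDerivAt_edx hΩ h).add ((hb.hasDerivAt_edx hΩ h).mul_const p)).add
    ((hc.hasDerivAt_edx hΩ h).mul_const (p ^ 2))).congr_of_eventuallyEq
      ((eventually_mem_slices hΩ h).1.mono fun _ ht => hf _ _ ht p)).deriv

theorem pdy_of_quadraticOn (hΩ : IsOpen Ω) (ha : SmoothOn2 Ω a) (hb : SmoothOn2 Ω b)
    (hc : SmoothOn2 Ω c)
    (hf : ∀ x y, (x, y) ∈ Ω → ∀ p, f x y p = a x y + b x y * p + c x y * p ^ 2)
    (h : (x, y) ∈ Ω) (p : ℝ) :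
    pdy f x y p = edy a x y + edy b x y * p + edy c x y * p ^ 2 :=
  ((((ha.hasDerivAt_edy hΩ h).add ((hb.hasDerivAt_edy hΩ h).mul_const p)).add
    ((hc.hasDerivAt_edy hΩ h).mul_const (p ^ 2))).congr_of_eventuallyEq
      ((eventually_mem_slices hΩ h).2.mono fun _ ht => hf _ _ ht p)).deriv

end QuadraticOn

/-- If `(x, y) ↦ (x + C, η(x, y))` maps `y'' = f(x, y, y')` to the first
Painlevé equation `ȳ'' = 6ȳ² + x̄` (prolongation identity
`η_xx + 2p·η_xy + p²·η_yy + η_y·f = 6η² + x + C` on `Ω × ℝ`, with `η_y ≠ 0`), then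
`f_ppp = 0` and `f_xpp = f_yp - p·f_ypp` on `Ω × ℝ` (vanishing of the fundamental
invariants `I₂` and `I₃`). -/
theorem statement12
    (Ω : Set (ℝ × ℝ)) (hΩo : IsOpen Ω) (hΩc : IsConnected Ω)
    (f : ℝ → ℝ → ℝ → ℝ)
    (hf : ContDiffOn ℝ (⊤ : ℕ∞) (fun z : ℝ × ℝ × ℝ => f z.1 z.2.1 z.2.2)
      {z : ℝ × ℝ × ℝ | (z.1, z.2.1) ∈ Ω})
    (C : ℝ) (η : ℝ → ℝ → ℝ)
    (hη : ContDiffOn ℝ (⊤ : ℕ∞) (fun w : ℝ × ℝ => η w.1 w.2) Ω)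
    (hηy : ∀ w ∈ Ω, edy η w.1 w.2 ≠ 0)
    (hpde : ∀ w ∈ Ω, ∀ p : ℝ,
      edx (edx η) w.1 w.2 + 2 * p * edx (edy η) w.1 w.2
        + p ^ 2 * edy (edy η) w.1 w.2 + edy η w.1 w.2 * f w.1 w.2 p
      = 6 * (η w.1 w.2) ^ 2 + w.1 + C) :
    ∀ w ∈ Ω, ∀ p : ℝ,
      pdp (pdp (pdp f)) w.1 w.2 p = 0 ∧
      pdp (pdp (pdx f)) w.1 w.2 p =
        pdp (pdy f) w.1 w.2 p - p * pdp (pdp (pdy f)) w.1 w.2 p := by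
  have hg : SmoothOn2 Ω (edy η) := SmoothOn2.partial_snd hη hΩo
  set a : ℝ → ℝ → ℝ := fun x y => (6 * η x y ^ 2 + x + C - edx (edx η) x y) / edy η x y with ha_def
  set b : ℝ → ℝ → ℝ := fun x y => -2 * edx (edy η) x y / edy η x y with hb_def
  set c : ℝ → ℝ → ℝ := fun x y => -edy (edy η) x y / edy η x y with hc_def
  have ha : SmoothOn2 Ω a :=
    ContDiffOn.div ((((contDiffOn_const.mul (hη.pow 2)).add contDiffOn_fst).add
      contDiffOn_const).sub (SmoothOn2.partial_fst (SmoothOn2.partial_fst hη hΩo) hΩo)) hg hηy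
  have hb : SmoothOn2 Ω b :=
    ContDiffOn.div (contDiffOn_const.mul (hg.partial_fst hΩo)) hg hηy
  have hc : SmoothOn2 Ω c := ContDiffOn.div (ContDiffOn.neg (hg.partial_snd hΩo)) hg hηy
  have hquad : ∀ x y, (x, y) ∈ Ω → ∀ p, f x y p = a x y + b x y * p + c x y * p ^ 2 := by
    intro x y h p
    have h0 : edy η x y ≠ 0 := hηy _ h
    have h1 := hpde _ h p
    simp only [ha_def, hb_def, hc_def]
    field_simp
    linear_combination h1
  rintro ⟨x, y⟩ h p
  refine ⟨pdp_pdp_pdp_of_quadratic (hquad x y h) p, ?_⟩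
  have h0 : edy η x y ≠ 0 := hηy _ h
  have hcx :=
    (((hg.partial_snd hΩo).hasDerivAt_edx hΩo h).neg.div (hg.hasDerivAt_edx hΩo h) h0).deriv
  have hby :=
    ((((hg.partial_fst hΩo).hasDerivAt_edy hΩo h).const_mul (-2)).div (hg.hasDerivAt_edy hΩo h) h0).deriv
  change edx c x y = _ at hcx
  change edy b x y = _ at hby
  have hcomm := hg.edx_edy_comm hΩo h
  dsimp only
  rw [pdp_pdp_of_quadratic (pdx_of_quadraticOn hΩo ha hb hc hquad h),
    pdp_of_quadratic (pdy_of_quadraticOn hΩo ha hb hc hquad h),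
    pdp_pdp_of_quadratic (pdy_of_quadraticOn hΩo ha hb hc hquad h), hcx, hby, hcomm]
  simp only [Pi.neg_apply]
  ring
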